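/- arXiv:1410.7036 — 2 statements merged into one kernel-verified Lean document; each statement's English description precedes it below -/
import Mathlib

section
/- ln(2/π) = -1/2 + Σ_{n=1}^∞ (N₁(n) - N₀(n))/(2n(2n+1)(2n+2)), where N₁(n) is the number of ones and N₀(n) the number of zeros in the binary expansion of n. -/
/-- The number of ones minus the number of zeros in the binary expansion of `n`. -/
def onesSubZeros (n : ℕ) : ℤ :=
  ((Nat.digits 2 n).count 1 : ℤ) - ((Nat.digits 2 n).count 0 : ℤ)

lemma onesSubZeros_two_mul {n : ℕ} (hn : n ≠ 0) :
    onesSubZeros (2 * n) = onesSubZeros n - 1 := by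
  have h := Nat.digits_add 2 (by norm_num) 0 n (by norm_num) (Or.inr hn)
  rw [zero_add] at h
  simp only [onesSubZeros, h, List.count_cons]
  simp
  ring

lemma onesSubZeros_two_mul_add_one (n : ℕ) :
    onesSubZeros (2 * n + 1) = onesSubZeros n + 1 := by
  have h := Nat.digits_add 2 (by norm_num) 1 n (by norm_num) (Or.inl one_ne_zero)
  rw [add_comm] at h
  simp only [onesSubZeros, h, List.count_cons]
  simp
  ring

lemma abs_onesSubZeros_le {n : ℕ} (hn : n ≠ 0) : |onesSubZeros n| ≤ n := by
  have h1 := List.count_le_length (a := 1) (l := Nat.digits 2 n)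
  have h0 := List.count_le_length (a := 0) (l := Nat.digits 2 n)
  rw [Nat.length_digits 2 n (by norm_num) hn] at h1 h0
  have hlog := Nat.log_lt_self 2 hn
  rw [onesSubZeros, abs_le]
  omega

/-- The error of the trapezoidal rule for `∫ 1 / t` over `[x, x + 1]`. -/
noncomputable def trapezoidError (x : ℝ) : ℝ :=
  1 / (2 * x) + 1 / (2 * (x + 1)) - (Real.log (x + 1) - Real.log x)

lemma trapezoidError_sub {x : ℝ} (hx : 0 < x) :
    trapezoidError x - trapezoidError (2 * x) - trapezoidError (2 * x + 1) =
      1 / (2 * x * (2 * x + 1) * (2 * x + 2)) := by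
  have h1 : Real.log (2 * x + 1 + 1) = Real.log 2 + Real.log (x + 1) := by
    rw [← Real.log_mul (by norm_num) (by positivity)]
    ring_nf
  have h2 : Real.log (2 * x) = Real.log 2 + Real.log x :=
    Real.log_mul (by norm_num) hx.ne'
  simp only [trapezoidError, h1, h2]
  have h3 : 2 * x + 1 + 1 = 2 * (x + 1) := by ring
  have h4 : 2 * x + 2 = 2 * (x + 1) := by ring
  rw [h3, h4]
  field_simp
  ring

lemma abs_trapezoidError_le {x : ℝ} (hx : 0 < x) :
    |trapezoidError x| ≤ 3 / 2 / (x * (x + 1) ^ 2) := by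
  have hlt : |1 / (x + 1)| < 1 := by
    rw [abs_of_pos (by positivity), div_lt_one (by positivity)]
    linarith
  have h := Real.abs_log_sub_add_sum_range_le hlt 2
  have hlog : Real.log (1 - 1 / (x + 1)) = Real.log x - Real.log (x + 1) := by
    rw [← Real.log_div hx.ne' (by positivity)]
    congr 1
    field_simp
    ring
  have hbound : |1 / (x + 1)| ^ (2 + 1) / (1 - |1 / (x + 1)|) = 1 / (x * (x + 1) ^ 2) := by
    rw [abs_of_pos (by positivity)]
    have : 1 - 1 / (x + 1) = x / (x + 1) := by
      field_simp
      ring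
    rw [this, div_pow, one_pow]
    field_simp
  rw [hlog, hbound] at h
  have key : trapezoidError x = 1 / 2 / (x * (x + 1) ^ 2) +
      (∑ i ∈ Finset.range 2, (1 / (x + 1)) ^ (i + 1) / (i + 1) +
        (Real.log x - Real.log (x + 1))) := by
    simp only [trapezoidError, Finset.sum_range_succ, Finset.sum_range_zero]
    push_cast
    field_simp
    ring
  rw [key]
  refine (abs_add_le _ _).trans ((add_le_add_right h _).trans_eq ?_)
  rw [abs_of_pos (by positivity)]
  ring

lemma summable_of_abs_le_div_sq {f : ℕ → ℝ} (C : ℝ)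
    (hf : ∀ n : ℕ, |f n| ≤ C / ((n : ℝ) + 1) ^ 2) : Summable f := by
  have h : Summable fun n : ℕ => C * (1 / (((n + 1 : ℕ) : ℝ) ^ 2)) :=
    ((summable_nat_add_iff 1).2 (Real.summable_one_div_nat_pow.2 one_lt_two)).mul_left C
  refine Summable.of_norm_bounded h fun n => (hf n).trans_eq ?_
  push_cast
  ring

lemma abs_onesSubZeros_succ_le (n : ℕ) : |(onesSubZeros (n + 1) : ℝ)| ≤ (n : ℝ) + 1 := by
  exact_mod_cast abs_onesSubZeros_le n.succ_ne_zero

lemma summable_onesSubZeros_mul_trapezoidError :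
    Summable fun n : ℕ => (onesSubZeros (n + 1) : ℝ) * trapezoidError (n + 1) := by
  refine summable_of_abs_le_div_sq (3 / 2) fun n => ?_
  have hn : (0 : ℝ) < (n : ℝ) + 1 := by positivity
  rw [abs_mul]
  calc _ ≤ ((n : ℝ) + 1) * (3 / 2 / (((n : ℝ) + 1) * ((n : ℝ) + 1 + 1) ^ 2)) :=
        mul_le_mul (abs_onesSubZeros_succ_le n) (abs_trapezoidError_le hn)
          (abs_nonneg _) hn.le
    _ = 3 / 2 / ((n : ℝ) + 1 + 1) ^ 2 := by field_simp
    _ ≤ _ := by gcongr; linarith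

lemma summable_onesSubZeros_div :
    Summable fun n : ℕ => (onesSubZeros (n + 1) : ℝ) /
      (2 * (n + 1 : ℝ) * (2 * (n + 1 : ℝ) + 1) * (2 * (n + 1 : ℝ) + 2)) := by
  refine summable_of_abs_le_div_sq 1 fun n => ?_
  have hn : (0 : ℝ) < (n : ℝ) + 1 := by positivity
  rw [abs_div, abs_of_pos (a := 2 * (n + 1 : ℝ) * _ * _) (by positivity),
    div_le_div_iff₀ (by positivity) (by positivity)]
  calc _ ≤ ((n : ℝ) + 1) * ((n : ℝ) + 1) ^ 2 := by
        gcongr; exact abs_onesSubZeros_succ_le n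
    _ ≤ _ := by
        generalize (n : ℝ) + 1 = x at hn
        nlinarith [pow_pos hn 2, pow_pos hn 3]

lemma sum_range_onesSubZeros_div (N : ℕ) :
    ∑ n ∈ Finset.range N, (onesSubZeros (n + 1) : ℝ) /
      (2 * (n + 1 : ℝ) * (2 * (n + 1 : ℝ) + 1) * (2 * (n + 1 : ℝ) + 2)) =
    trapezoidError 1 +
      (∑ n ∈ Finset.range N, (onesSubZeros (n + 1) : ℝ) * trapezoidError (n + 1) -
        ∑ n ∈ Finset.range (2 * N + 1),
          (onesSubZeros (n + 1) : ℝ) * trapezoidError (n + 1)) +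
      ∑ n ∈ Finset.range N,
        (trapezoidError (2 * (n + 1) + 1) - trapezoidError (2 * (n + 1))) := by
  induction N with
  | zero => simp [onesSubZeros]
  | succ N ih =>
    have h := trapezoidError_sub (x := (N : ℝ) + 1) (by positivity)
    have e0 : onesSubZeros (2 * N + 1 + 1) = onesSubZeros (N + 1) - 1 :=
      onesSubZeros_two_mul N.succ_ne_zero
    have e1 : onesSubZeros (2 * N + 1 + 1 + 1) = onesSubZeros (N + 1) + 1 :=
      onesSubZeros_two_mul_add_one (N + 1)
    have c0 : ((2 * N + 1 : ℕ) : ℝ) + 1 = 2 * ((N : ℝ) + 1) := by push_cast; ring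
    have c1 : ((2 * N + 1 + 1 : ℕ) : ℝ) + 1 = 2 * ((N : ℝ) + 1) + 1 := by push_cast; ring
    rw [show 2 * (N + 1) + 1 = 2 * N + 1 + 1 + 1 by ring]
    simp only [Finset.sum_range_succ _ N, Finset.sum_range_succ _ (2 * N + 1),
      Finset.sum_range_succ _ (2 * N + 1 + 1)]
    rw [ih, e0, e1, c0, c1, div_eq_mul_one_div, ← h]
    push_cast
    ring

lemma sum_range_trapezoidError_sub (N : ℕ) :
    ∑ n ∈ Finset.range N,
      (trapezoidError (2 * (n + 1) + 1) - trapezoidError (2 * (n + 1))) =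
    1 / (4 * ((N : ℝ) + 1)) - 1 / 4 -
      (Real.log (Real.Wallis.W N) + Real.log (((N : ℝ) + 1) / (2 * N + 1))) := by
  induction N with
  | zero => simp [Real.Wallis.W]
  | succ N ih =>
    have hW := Real.Wallis.W_pos N
    rw [Finset.sum_range_succ, ih, Real.Wallis.W_succ,
      Real.log_mul hW.ne' (by positivity)]
    push_cast
    rw [Real.log_mul (by positivity) (by positivity),
      Real.log_div (by positivity) (by positivity),
      Real.log_div (by positivity) (by positivity),
      Real.log_div (by positivity) (by positivity),
      Real.log_div (by positivity) (by positivity)]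
    have c1 : 2 * ((N : ℝ) + 1) = 2 * N + 2 := by ring
    have c2 : 2 * (N : ℝ) + 2 + 1 = 2 * N + 3 := by ring
    have c3 : 2 * (N : ℝ) + 3 + 1 = 2 * (N + 1 + 1) := by ring
    have l1 : Real.log (2 * (N : ℝ) + 2) = Real.log 2 + Real.log (N + 1) := by
      rw [← c1, Real.log_mul (by norm_num) (by positivity)]
    have l2 : Real.log (2 * ((N : ℝ) + 1 + 1)) = Real.log 2 + Real.log (N + 1 + 1) :=
      Real.log_mul (by norm_num) (by positivity)
    simp only [trapezoidError, c1, c2, c3, l1, l2]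
    field_simp
    ring

open Filter Topology in
lemma tendsto_sum_range_trapezoidError_sub :
    Tendsto (fun N : ℕ => ∑ n ∈ Finset.range N,
      (trapezoidError (2 * (n + 1) + 1) - trapezoidError (2 * (n + 1)))) atTop
      (𝓝 (-(1 / 4) - (Real.log (Real.pi / 2) - Real.log 2))) := by
  have hinv : Tendsto (fun N : ℕ => 1 / ((N : ℝ) + 1)) atTop (𝓝 0) :=
    tendsto_one_div_add_atTop_nhds_zero_nat
  have h1 : Tendsto (fun N : ℕ => 1 / (4 * ((N : ℝ) + 1))) atTop (𝓝 0) := by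
    have h := hinv.const_mul (1 / 4)
    rw [mul_zero] at h
    exact h.congr fun N => one_div_mul_one_div _ _
  have h2 : Tendsto (fun N : ℕ => ((N : ℝ) + 1) / (2 * N + 1)) atTop (𝓝 (1 / 2)) := by
    have h : Tendsto (fun N : ℕ => 1 / (2 - 1 / ((N : ℝ) + 1))) atTop (𝓝 (1 / (2 - 0))) :=
      tendsto_const_nhds.div (tendsto_const_nhds.sub hinv) (by norm_num)
    rw [sub_zero] at h
    refine h.congr fun N => ?_
    have : 2 - 1 / ((N : ℝ) + 1) = (2 * N + 1) / (N + 1) := by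
      field_simp
      ring
    rw [this, one_div_div]
  have h3 := Real.Wallis.tendsto_W_nhds_pi_div_two.log (by positivity)
  have h4 := h2.log (by norm_num)
  have h5 := (h1.sub_const (1 / 4)).sub (h3.add h4)
  have e : Real.log (1 / 2) = -Real.log 2 := by rw [one_div, Real.log_inv]
  rw [e, zero_sub, ← sub_eq_add_neg] at h5
  exact h5.congr fun N => (sum_range_trapezoidError_sub N).symm

open Filter Topology in
/-- `ln(2/π) = -1/2 + Σ_{n≥1} (N₁(n)-N₀(n))/(2n(2n+1)(2n+2))`. -/
theorem log_two_div_pi_series :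
    Real.log (2 / Real.pi) =
      -(1 / 2) + ∑' n : ℕ,
        ((((Nat.digits 2 (n + 1)).count 1 : ℤ) - ((Nat.digits 2 (n + 1)).count 0 : ℤ) : ℤ) : ℝ) /
          (2 * (n + 1 : ℝ) * (2 * (n + 1 : ℝ) + 1) * (2 * (n + 1 : ℝ) + 2)) := by
  have hU := summable_onesSubZeros_mul_trapezoidError.hasSum.tendsto_sum_nat
  have hodd : Tendsto (fun N : ℕ => 2 * N + 1) atTop atTop :=
    tendsto_atTop_mono (fun N => show N ≤ 2 * N + 1 by omega) tendsto_id
  have hlim := ((hU.sub (hU.comp hodd)).const_add (trapezoidError 1)).add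
    tendsto_sum_range_trapezoidError_sub
  have hsum := tendsto_nhds_unique summable_onesSubZeros_div.hasSum.tendsto_sum_nat
    (hlim.congr fun N => (sum_range_onesSubZeros_div N).symm)
  change _ = -(1 / 2) + ∑' n : ℕ, (onesSubZeros (n + 1) : ℝ) / _
  rw [hsum, trapezoidError, Real.log_div (by norm_num) Real.pi_ne_zero,
    Real.log_div Real.pi_ne_zero (by norm_num)]
  norm_num
  ring
end

section
/- ln(4/π) = Σ_{n=1}^∞ (-1)^{n-1} (1/n - ∫_n^{n+1} dt/t), i.e. ln(4/π) = Σ_{n=1}^∞ (-1)^{n-1}(1/n - ln((n+1)/n)), where the series converges absolutely since 0 ≤ 1/n - ln((n+1)/n) ≤ 1/n². -/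
open Filter Topology Finset

theorem integral_one_div_add_one {x : ℝ} (hx : 0 < x) :
    ∫ t in x..(x + 1), 1 / t = Real.log ((x + 1) / x) :=
  integral_one_div_of_pos hx (by linarith)

theorem log_add_one_div_le {x : ℝ} (hx : 0 < x) : Real.log ((x + 1) / x) ≤ 1 / x := by
  have h := Real.log_le_sub_one_of_pos (x := (x + 1) / x) (by positivity)
  have e : (x + 1) / x - 1 = 1 / x := by field_simp; ring
  linarith

theorem one_div_sub_log_le {x : ℝ} (hx : 0 < x) :
    1 / x - Real.log ((x + 1) / x) ≤ 1 / x ^ 2 := by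
  have h := Real.one_sub_inv_le_log_of_pos (x := (x + 1) / x) (by positivity)
  have e : 1 / x ^ 2 - (1 / x - (1 - ((x + 1) / x)⁻¹)) = 1 / (x ^ 2 * (x + 1)) := by
    field_simp; ring
  have : 0 < 1 / (x ^ 2 * (x + 1)) := by positivity
  linarith

theorem summable_alternating_one_div_sub_log :
    Summable fun n : ℕ => (-1 : ℝ) ^ n *
      (1 / (n + 1 : ℝ) - Real.log (((n + 1 : ℝ) + 1) / (n + 1 : ℝ))) := by
  have hs : Summable fun n : ℕ => 1 / (n + 1 : ℝ) ^ 2 := by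
    simpa using (summable_nat_add_iff 1).2 (Real.summable_one_div_nat_pow.2 one_lt_two)
  refine Summable.of_norm_bounded hs fun n => ?_
  have hn : (0 : ℝ) < n + 1 := by positivity
  rw [norm_mul, norm_pow, norm_neg, norm_one, one_pow, one_mul, Real.norm_eq_abs,
    abs_of_nonneg (sub_nonneg.2 (log_add_one_div_le hn))]
  exact one_div_sub_log_le hn

theorem sum_range_alternating_one_div_sub_log (N : ℕ) :
    ∑ n ∈ range (2 * N), (-1 : ℝ) ^ n *
      (1 / (n + 1 : ℝ) - Real.log (((n + 1 : ℝ) + 1) / (n + 1 : ℝ))) =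
      (harmonic (2 * N) : ℝ) - harmonic N - Real.log (Real.Wallis.W N) := by
  induction N with
  | zero => simp [Real.Wallis.W]
  | succ N ih =>
    have hW : Real.log (Real.Wallis.W (N + 1)) = Real.log (Real.Wallis.W N) +
        (Real.log ((2 * N + 2) / (2 * N + 1)) - Real.log ((2 * N + 3) / (2 * N + 2))) := by
      rw [Real.Wallis.W_succ, Real.log_mul (Real.Wallis.W_pos N).ne' (by positivity),
        Real.log_mul (by positivity) (by positivity),
        ← inv_div (2 * N + 3 : ℝ) (2 * N + 2), Real.log_inv]
      ring
    rw [show 2 * (N + 1) = 2 * N + 1 + 1 by ring, sum_range_succ, sum_range_succ, ih, hW,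
      harmonic_succ, harmonic_succ, harmonic_succ, pow_succ, pow_mul]
    push_cast
    rw [show (2 * N + 1 + 1 : ℝ) = 2 * N + 2 by ring,
      show (2 * N + 2 + 1 : ℝ) = 2 * N + 3 by ring]
    field_simp
    ring

theorem tendsto_harmonic_two_mul_sub_harmonic :
    Tendsto (fun N : ℕ => (harmonic (2 * N) : ℝ) - harmonic N) atTop (𝓝 (Real.log 2)) := by
  have h := Real.tendsto_harmonic_sub_log
  have h2 : Tendsto (fun N : ℕ => 2 * N) atTop atTop :=
    tendsto_id.const_mul_atTop' two_pos
  have h3 := ((h.comp h2).sub h).add_const (Real.log 2)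
  rw [sub_self, zero_add] at h3
  refine h3.congr' ?_
  filter_upwards [eventually_gt_atTop 0] with N hN
  have hN' : (N : ℝ) ≠ 0 := by exact_mod_cast hN.ne'
  simp only [Function.comp_apply]
  push_cast
  rw [Real.log_mul two_ne_zero hN']
  ring

/-- `ln(4/π) = Σ_{n≥1} (-1)^{n-1} (1/n - ∫_n^{n+1} dt/t)`. -/
theorem log_four_div_pi_alternating :
    Real.log (4 / Real.pi) =
      ∑' n : ℕ, (-1 : ℝ) ^ n *
        (1 / (n + 1 : ℝ) - ∫ t in (n + 1 : ℝ)..((n + 1 : ℝ) + 1), 1 / t) := by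
  have hint (n : ℕ) := integral_one_div_add_one (x := n + 1) (by positivity)
  simp_rw [hint]
  have hπ : Real.log (4 / Real.pi) = Real.log 2 - Real.log (Real.pi / 2) := by
    rw [← Real.log_div two_ne_zero (by positivity)]
    congr 1
    field_simp
    norm_num
  have hlim := tendsto_harmonic_two_mul_sub_harmonic.sub
    (Real.Wallis.tendsto_W_nhds_pi_div_two.log (by positivity))
  simp_rw [← sum_range_alternating_one_div_sub_log, ← hπ] at hlim
  exact tendsto_nhds_unique hlim
    (summable_alternating_one_div_sub_log.hasSum.tendsto_sum_nat.comp
      (tendsto_id.const_mul_atTop' two_pos))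
end
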